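/- Let m, n ≥ 1, let f ≤ g be integer m×n matrices, and let α ≤ β be integers. There exists a partial alternating sign matrix M of size m×n with f ≤ M ≤ g and α ≤ M̃(S_{m,n}) ≤ β if and only if the following four inequalities hold for every X₁, X₂ ⊆ S_{m,n}: (1) p*₁(X₁) + f̃(X₂ − X₁) ≤ b*₂(X₂) + g̃(X₁ − X₂); (2) p*₂(X₂) + f̃(X₁ − X₂) ≤ b*₁(X₁) + g̃(X₂ − X₁); (3) b*₁(X₁) + b*₂(X₂) + g̃(X₁ᶜ ∩ X₂ᶜ) − f̃(X₁ ∩ X₂) ≥ α; (4) p*₁(X₁) + p*₂(X₂) + f̃(X₁ᶜ ∩ X₂ᶜ) − g̃(X₁ ∩ X₂) ≤ β; where b*₁(X) := σ₁(X) and b*₂(X) := σ₂(X), p*₁(X) := −(the number of maximal horizontal segments of X that do not start in the first column), and p*₂(X) := −(the number of maximal vertical segments of X that do not start in the first row). -/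

import Mathlib

/-- The set of positions of an m×n matrix, 1-based: S_{m,n} = [m] × [n]. -/
def Smn (m n : ℕ) : Finset (ℕ × ℕ) := Finset.Icc 1 m ×ˢ Finset.Icc 1 n

/-- The horizontal prefix P¹_{i,j} = {(i,1), …, (i,j)}. -/
def hPrefix (i j : ℕ) : Finset (ℕ × ℕ) := {i} ×ˢ Finset.Icc 1 j

/-- The vertical prefix P²_{i,j} = {(1,j), …, (i,j)}. -/
def vPrefix (i j : ℕ) : Finset (ℕ × ℕ) := Finset.Icc 1 i ×ˢ {j}

/-- x̃(X), the sum of the entries of x at the positions in X. -/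
def fsum (x : ℕ × ℕ → ℤ) (X : Finset (ℕ × ℕ)) : ℤ := ∑ s ∈ X, x s

/-- A is a prefix-bounded matrix (PBM) of size m×n with respect to the
horizontal-prefix bounds Φ1 ≤ Γ1 and the vertical-prefix bounds Φ2 ≤ Γ2. -/
def IsPBM (m n : ℕ) (Φ1 Γ1 Φ2 Γ2 : ℕ × ℕ → ℤ) (A : ℕ × ℕ → ℤ) : Prop :=
  ∀ i ∈ Finset.Icc 1 m, ∀ j ∈ Finset.Icc 1 n,
    (Φ1 (i, j) ≤ fsum A (hPrefix i j) ∧ fsum A (hPrefix i j) ≤ Γ1 (i, j)) ∧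
    (Φ2 (i, j) ≤ fsum A (vPrefix i j) ∧ fsum A (vPrefix i j) ≤ Γ2 (i, j))

/-- Starting positions of the maximal horizontal segments of X ⊆ S_{m,n}. -/
def hStarts (X : Finset (ℕ × ℕ)) : Finset (ℕ × ℕ) :=
  X.filter (fun s => (s.1, s.2 - 1) ∉ X)

/-- Ending positions of the maximal horizontal segments of X ⊆ S_{m,n}. -/
def hEnds (X : Finset (ℕ × ℕ)) : Finset (ℕ × ℕ) :=
  X.filter (fun s => (s.1, s.2 + 1) ∉ X)

/-- Starting positions of the maximal vertical segments of X ⊆ S_{m,n}. -/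
def vStarts (X : Finset (ℕ × ℕ)) : Finset (ℕ × ℕ) :=
  X.filter (fun s => (s.1 - 1, s.2) ∉ X)

/-- Ending positions of the maximal vertical segments of X ⊆ S_{m,n}. -/
def vEnds (X : Finset (ℕ × ℕ)) : Finset (ℕ × ℕ) :=
  X.filter (fun s => (s.1 + 1, s.2) ∉ X)

/-- σ₁(X): the number of maximal horizontal segments of X. -/
def sigma1 (X : Finset (ℕ × ℕ)) : ℕ := (hStarts X).card

/-- σ₂(X): the number of maximal vertical segments of X. -/
def sigma2 (X : Finset (ℕ × ℕ)) : ℕ := (vStarts X).card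

/-- p*₁(X) = Σ [Φ¹(i,j₂) − Γ¹(i,j₁−1)] over the maximal horizontal segments
{(i,j₁),…,(i,j₂)} of X, with the convention Γ¹(i,0) = 0. -/
def pstar1 (Φ1 Γ1 : ℕ × ℕ → ℤ) (X : Finset (ℕ × ℕ)) : ℤ :=
  ∑ s ∈ hEnds X, Φ1 s -
    ∑ s ∈ hStarts X, (if s.2 = 1 then 0 else Γ1 (s.1, s.2 - 1))

/-- b*₁(X) = Σ [Γ¹(i,j₂) − Φ¹(i,j₁−1)] over the maximal horizontal segments
{(i,j₁),…,(i,j₂)} of X, with the convention Φ¹(i,0) = 0. -/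
def bstar1 (Φ1 Γ1 : ℕ × ℕ → ℤ) (X : Finset (ℕ × ℕ)) : ℤ :=
  ∑ s ∈ hEnds X, Γ1 s -
    ∑ s ∈ hStarts X, (if s.2 = 1 then 0 else Φ1 (s.1, s.2 - 1))

/-- p*₂(X) = Σ [Φ²(i₂,j) − Γ²(i₁−1,j)] over the maximal vertical segments
{(i₁,j),…,(i₂,j)} of X, with the convention Γ²(0,j) = 0. -/
def pstar2 (Φ2 Γ2 : ℕ × ℕ → ℤ) (X : Finset (ℕ × ℕ)) : ℤ :=
  ∑ s ∈ vEnds X, Φ2 s -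
    ∑ s ∈ vStarts X, (if s.1 = 1 then 0 else Γ2 (s.1 - 1, s.2))

/-- b*₂(X) = Σ [Γ²(i₂,j) − Φ²(i₁−1,j)] over the maximal vertical segments
{(i₁,j),…,(i₂,j)} of X, with the convention Φ²(0,j) = 0. -/
def bstar2 (Φ2 Γ2 : ℕ × ℕ → ℤ) (X : Finset (ℕ × ℕ)) : ℤ :=
  ∑ s ∈ vEnds X, Γ2 s -
    ∑ s ∈ vStarts X, (if s.1 = 1 then 0 else Φ2 (s.1 - 1, s.2))

/-- M is a partial alternating sign matrix (PASM) of size m×n: every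
horizontal and vertical prefix sum lies in {0, 1}. -/
def IsPASM (m n : ℕ) (M : ℕ × ℕ → ℤ) : Prop :=
  ∀ i ∈ Finset.Icc 1 m, ∀ j ∈ Finset.Icc 1 n,
    (fsum M (hPrefix i j) = 0 ∨ fsum M (hPrefix i j) = 1) ∧
    (fsum M (vPrefix i j) = 0 ∨ fsum M (vPrefix i j) = 1)

/-- p*₁ for PASMs: minus the number of maximal horizontal segments of X that
do not start in the first column. -/
def pasmPstar1 (X : Finset (ℕ × ℕ)) : ℤ :=
  -(((hStarts X).filter (fun s => s.2 ≠ 1)).card : ℤ)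

/-- p*₂ for PASMs: minus the number of maximal vertical segments of X that do
not start in the first row. -/
def pasmPstar2 (X : Finset (ℕ × ℕ)) : ℤ :=
  -(((vStarts X).filter (fun s => s.1 ≠ 1)).card : ℤ)

section Circulation

variable {V E : Type*}

open Classical in
/-- The contribution to the slack of a cut of an arc with capacities `l ≤ u` whose tail (head) lies
inside the cut when `P` (`Q`) holds. -/
noncomputable def arcSlack (P Q : Prop) (l u : ℤ) : ℤ :=
  (if P ∧ ¬ Q then u else 0) - (if Q ∧ ¬ P then l else 0)

/-- The slack of the cut `Z`: upper capacities of the arcs leaving `Z` minus lower capacities of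
the arcs entering `Z`. -/
noncomputable def cutSlack (A : Finset E) (src tgt : E → V) (l u : E → ℤ) (Z : Set V) : ℤ :=
  ∑ e ∈ A, arcSlack (src e ∈ Z) (tgt e ∈ Z) (l e) (u e)

open Classical in
theorem cutSlack_sub_upper (A : Finset E) (src tgt : E → V) (l u : E → ℤ) (Z : Set V)
    {e : E} (he : e ∈ A) :
    cutSlack A src tgt l (fun a => u a - if a = e then 1 else 0) Z =
      cutSlack A src tgt l u Z - if src e ∈ Z ∧ tgt e ∉ Z then 1 else 0 := by
  have h : (if src e ∈ Z ∧ tgt e ∉ Z then (1 : ℤ) else 0) =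
      ∑ a ∈ A, if a = e then (if src e ∈ Z ∧ tgt e ∉ Z then (1 : ℤ) else 0) else 0 := by
    rw [Finset.sum_ite_eq_of_mem' A e _ he]
  unfold cutSlack arcSlack
  rw [h, ← Finset.sum_sub_distrib]
  refine Finset.sum_congr rfl fun a _ => ?_
  by_cases hae : a = e
  · subst hae
    split_ifs <;> simp_all
  · simp [hae]

open Classical in
theorem cutSlack_add_lower (A : Finset E) (src tgt : E → V) (l u : E → ℤ) (Z : Set V)
    {e : E} (he : e ∈ A) :
    cutSlack A src tgt (fun a => l a + if a = e then 1 else 0) u Z =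
      cutSlack A src tgt l u Z - if tgt e ∈ Z ∧ src e ∉ Z then 1 else 0 := by
  have h : (if tgt e ∈ Z ∧ src e ∉ Z then (1 : ℤ) else 0) =
      ∑ a ∈ A, if a = e then (if tgt e ∈ Z ∧ src e ∉ Z then (1 : ℤ) else 0) else 0 := by
    rw [Finset.sum_ite_eq_of_mem' A e _ he]
  unfold cutSlack arcSlack
  rw [h, ← Finset.sum_sub_distrib]
  refine Finset.sum_congr rfl fun a _ => ?_
  by_cases hae : a = e
  · subst hae
    split_ifs <;> simp_all
    ring
  · simp [hae]

/-- Submodularity of the cut slack, strict when a non-rigid arc crosses between the two sets. -/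
theorem cutSlack_inter_add_union_lt (A : Finset E) (src tgt : E → V) (l u : E → ℤ)
    (hlu : ∀ e ∈ A, l e ≤ u e) (Z W : Set V) {e : E} (he : e ∈ A) (hlt : l e < u e)
    (htZ : tgt e ∈ Z) (hsZ : src e ∉ Z) (htW : tgt e ∉ W) (hsW : src e ∈ W) :
    cutSlack A src tgt l u (Z ∩ W) + cutSlack A src tgt l u (Z ∪ W) <
      cutSlack A src tgt l u Z + cutSlack A src tgt l u W := by
  classical
  unfold cutSlack arcSlack
  rw [← Finset.sum_add_distrib, ← Finset.sum_add_distrib]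
  refine Finset.sum_lt_sum (fun a ha => ?_) ⟨e, he, ?_⟩
  · have := hlu a ha
    by_cases h1 : src a ∈ Z <;> by_cases h2 : src a ∈ W <;> by_cases h3 : tgt a ∈ Z <;>
      by_cases h4 : tgt a ∈ W <;> simp [h1, h2, h3, h4] <;> omega
  · simp [htZ, hsZ, htW, hsW]
    omega

/-- Hoffman's circulation theorem (integral form): if every cut has nonnegative slack, there is an
integral circulation within the capacities. Conservation is stated across every vertex set. -/
theorem exists_circulation (A : Finset E) (src tgt : E → V) (l u : E → ℤ)
    (hlu : ∀ e ∈ A, l e ≤ u e) (hcut : ∀ Z, 0 ≤ cutSlack A src tgt l u Z) :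
    ∃ x : E → ℤ, (∀ e ∈ A, l e ≤ x e ∧ x e ≤ u e) ∧ ∀ Z, cutSlack A src tgt x x Z = 0 := by
  classical
  induction hN : (∑ e ∈ A, (u e - l e)).toNat using Nat.strong_induction_on generalizing l u with
  | _ N ih =>
  by_cases hrigid : ∀ e ∈ A, l e = u e
  · have hx : ∀ Z, cutSlack A src tgt l u Z = cutSlack A src tgt l l Z := fun Z =>
      Finset.sum_congr rfl fun e he => by rw [hrigid e he]
    refine ⟨l, fun e he => ⟨le_rfl, hlu e he⟩, fun Z => ?_⟩
    have h1 := hcut Z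
    have h2 := hcut Zᶜ
    rw [hx] at h1 h2
    have h3 : cutSlack A src tgt l l Zᶜ = - cutSlack A src tgt l l Z := by
      unfold cutSlack arcSlack
      rw [← Finset.sum_neg_distrib]
      refine Finset.sum_congr rfl fun e _ => ?_
      by_cases h1 : src e ∈ Z <;> by_cases h2 : tgt e ∈ Z <;> simp [h1, h2]
    omega
  · push Not at hrigid
    obtain ⟨e, he, hne⟩ := hrigid
    have hlt : l e < u e := lt_of_le_of_ne (hlu e he) hne
    have hpos : 0 < ∑ e ∈ A, (u e - l e) :=
      Finset.sum_pos' (fun a ha => sub_nonneg.2 (hlu a ha)) ⟨e, he, sub_pos.2 hlt⟩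
    have hone : ∑ a ∈ A, (if a = e then (1 : ℤ) else 0) = 1 :=
      Finset.sum_ite_eq_of_mem' A e _ he
    by_cases hl : ∀ Z, 0 ≤ cutSlack A src tgt (fun a => l a + if a = e then 1 else 0) u Z
    · obtain ⟨x, hx, hc⟩ := ih _ (by
        rw [Finset.sum_sub_distrib, Finset.sum_add_distrib, hone]
        rw [Finset.sum_sub_distrib] at hN hpos
        omega) (fun a => l a + if a = e then 1 else 0) u (fun a ha => by
          have := hlu a ha
          split_ifs with h
          · subst h; omega
          · omega) hl rfl
      refine ⟨x, fun a ha => ⟨?_, (hx a ha).2⟩, hc⟩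
      have := (hx a ha).1
      split_ifs at this <;> omega
    by_cases hu : ∀ Z, 0 ≤ cutSlack A src tgt l (fun a => u a - if a = e then 1 else 0) Z
    · obtain ⟨x, hx, hc⟩ := ih _ (by
        rw [Finset.sum_sub_distrib, Finset.sum_sub_distrib, hone]
        rw [Finset.sum_sub_distrib] at hN hpos
        omega) l (fun a => u a - if a = e then 1 else 0) (fun a ha => by
          have := hlu a ha
          split_ifs with h
          · subst h; omega
          · omega) hu rfl
      refine ⟨x, fun a ha => ⟨(hx a ha).1, ?_⟩, hc⟩
      have := (hx a ha).2
      split_ifs at this <;> omega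
    exfalso
    push Not at hl hu
    obtain ⟨Z, hZ⟩ := hl
    obtain ⟨W, hW⟩ := hu
    rw [cutSlack_add_lower _ _ _ _ _ _ he] at hZ
    rw [cutSlack_sub_upper _ _ _ _ _ _ he] at hW
    have hZ0 := hcut Z
    have hW0 := hcut W
    have hI := hcut (Z ∩ W)
    have hU := hcut (Z ∪ W)
    split_ifs at hZ with h1
    · split_ifs at hW with h2
      · have := cutSlack_inter_add_union_lt A src tgt l u hlu Z W he hlt h1.1 h1.2 h2.2 h2.1
        omega
      · omega
    · omega

end Circulation

section Segments

theorem mem_Smn {m n : ℕ} {s : ℕ × ℕ} :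
    s ∈ Smn m n ↔ (1 ≤ s.1 ∧ s.1 ≤ m) ∧ 1 ≤ s.2 ∧ s.2 ≤ n := by
  simp [Smn]

/-- Summing differences along the orbits of a partial shift telescopes to the segment ends. -/
theorem sum_sub_shift {ι : Type*} [DecidableEq ι] (X : Finset ι) (p q : ι → ι)
    (hpq : ∀ s, p (q s) = s) (hqp : ∀ s ∈ X, q (p s) = s) (H : ι → ℤ) :
    ∑ s ∈ X, (H s - H (p s)) =
      ∑ s ∈ X with q s ∉ X, H s - ∑ s ∈ X with p s ∉ X, H (p s) := by
  have h : ∑ s ∈ X with q s ∈ X, H s = ∑ s ∈ X with p s ∈ X, H (p s) := by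
    refine Finset.sum_bij' (fun s _ => q s) (fun s _ => p s) ?_ ?_ ?_ ?_ ?_
    · intro s hs
      simp_all
    · intro s hs
      simp_all
    · intro s _
      exact hpq s
    · intro s hs
      exact hqp s (Finset.mem_filter.1 hs).1
    · intro s _
      rw [hpq]
  rw [Finset.sum_sub_distrib, ← Finset.sum_filter_add_sum_filter_not X (fun s => q s ∈ X) H,
    ← Finset.sum_filter_add_sum_filter_not X (fun s => p s ∈ X) (fun s => H (p s)), h]
  ring

theorem card_filter_shift {ι : Type*} [DecidableEq ι] (X : Finset ι) (p q : ι → ι)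
    (hpq : ∀ s, p (q s) = s) (hqp : ∀ s ∈ X, q (p s) = s) :
    (X.filter fun s => q s ∉ X).card = (X.filter fun s => p s ∉ X).card := by
  have := sum_sub_shift X p q hpq hqp (fun _ => 1)
  simp only [sub_self, Finset.sum_const_zero, Finset.sum_const, nsmul_eq_mul, mul_one] at this
  omega

theorem card_filter_compl_shift {ι : Type*} [DecidableEq ι] (S X : Finset ι) (p q : ι → ι)
    (hpq : ∀ s, p (q s) = s) (hqp : ∀ s ∈ X, q (p s) = s) :
    (S.filter fun s => s ∉ X ∧ q s ∈ X).card = (X.filter fun s => p s ∉ X ∧ p s ∈ S).card := by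
  refine Finset.card_bij' (fun s _ => q s) (fun s _ => p s) ?_ ?_ ?_ ?_
  · intro s hs
    simp_all
  · intro s hs
    simp_all
  · intro s _
    exact hpq s
  · intro s hs
    exact hqp s (Finset.mem_filter.1 hs).1

theorem succ_pred_snd {m n : ℕ} {X : Finset (ℕ × ℕ)} (hX : X ⊆ Smn m n) :
    ∀ s ∈ X, (((s.1, s.2 - 1) : ℕ × ℕ).1, ((s.1, s.2 - 1) : ℕ × ℕ).2 + 1) = s := by
  intro s hs
  have := mem_Smn.1 (hX hs)
  ext <;> simp
  omega

theorem succ_pred_fst {m n : ℕ} {X : Finset (ℕ × ℕ)} (hX : X ⊆ Smn m n) :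
    ∀ s ∈ X, (((s.1 - 1, s.2) : ℕ × ℕ).1 + 1, ((s.1 - 1, s.2) : ℕ × ℕ).2) = s := by
  intro s hs
  have := mem_Smn.1 (hX hs)
  ext <;> simp
  omega

theorem sigma1_eq_card_hEnds {m n : ℕ} {X : Finset (ℕ × ℕ)} (hX : X ⊆ Smn m n) :
    sigma1 X = (hEnds X).card :=
  (card_filter_shift X (fun s => (s.1, s.2 - 1)) (fun s => (s.1, s.2 + 1))
    (fun s => by simp) (succ_pred_snd hX)).symm

theorem sigma2_eq_card_vEnds {m n : ℕ} {X : Finset (ℕ × ℕ)} (hX : X ⊆ Smn m n) :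
    sigma2 X = (vEnds X).card :=
  (card_filter_shift X (fun s => (s.1 - 1, s.2)) (fun s => (s.1 + 1, s.2))
    (fun s => by simp) (succ_pred_fst hX)).symm

theorem sigma1_eq_sum {m n : ℕ} {X : Finset (ℕ × ℕ)} (hX : X ⊆ Smn m n) :
    (sigma1 X : ℤ) = ∑ s ∈ Smn m n, if s ∈ X ∧ (s.1, s.2 + 1) ∉ X then 1 else 0 := by
  rw [sigma1_eq_card_hEnds hX, Finset.sum_boole, hEnds]
  congr 2
  ext s
  simp only [Finset.mem_filter]
  exact ⟨fun h => ⟨hX h.1, h⟩, fun h => h.2⟩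

theorem sigma2_eq_sum {m n : ℕ} {X : Finset (ℕ × ℕ)} (hX : X ⊆ Smn m n) :
    (sigma2 X : ℤ) = ∑ s ∈ Smn m n, if s ∈ X ∧ (s.1 + 1, s.2) ∉ X then 1 else 0 := by
  rw [sigma2_eq_card_vEnds hX, Finset.sum_boole, vEnds]
  congr 2
  ext s
  simp only [Finset.mem_filter]
  exact ⟨fun h => ⟨hX h.1, h⟩, fun h => h.2⟩

theorem pasmPstar1_eq_sum {m n : ℕ} {X : Finset (ℕ × ℕ)} (hX : X ⊆ Smn m n) :
    pasmPstar1 X = -∑ s ∈ Smn m n, if s ∉ X ∧ (s.1, s.2 + 1) ∈ X then 1 else 0 := by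
  rw [Finset.sum_boole, card_filter_compl_shift (Smn m n) X (fun s => (s.1, s.2 - 1))
    (fun s => (s.1, s.2 + 1)) (fun s => by simp) (succ_pred_snd hX), pasmPstar1, hStarts,
    Finset.filter_filter]
  congr 3
  refine Finset.filter_congr fun s hs => ?_
  have := mem_Smn.1 (hX hs)
  rw [mem_Smn]
  refine and_congr_right fun _ => ?_
  simp only
  omega

theorem pasmPstar2_eq_sum {m n : ℕ} {X : Finset (ℕ × ℕ)} (hX : X ⊆ Smn m n) :
    pasmPstar2 X = -∑ s ∈ Smn m n, if s ∉ X ∧ (s.1 + 1, s.2) ∈ X then 1 else 0 := by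
  rw [Finset.sum_boole, card_filter_compl_shift (Smn m n) X (fun s => (s.1 - 1, s.2))
    (fun s => (s.1 + 1, s.2)) (fun s => by simp) (succ_pred_fst hX), pasmPstar2, vStarts,
    Finset.filter_filter]
  congr 3
  refine Finset.filter_congr fun s hs => ?_
  have := mem_Smn.1 (hX hs)
  rw [mem_Smn]
  refine and_congr_right fun _ => ?_
  simp only
  omega

end Segments

section Necessity

/-- Bounds on a telescoping sum whose potential takes values in `{0, 1}` on `X`. -/
theorem sum_sub_shift_bounds {ι : Type*} [DecidableEq ι] (X : Finset ι) (p q : ι → ι)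
    (hpq : ∀ s, p (q s) = s) (hqp : ∀ s ∈ X, q (p s) = s) (H : ι → ℤ) (c : ι → Prop)
    [DecidablePred c] (hH : ∀ s ∈ X, 0 ≤ H s ∧ H s ≤ 1)
    (hp : ∀ s ∈ X, 0 ≤ H (p s) ∧ H (p s) ≤ 1) (hc : ∀ s ∈ X, ¬ c s → H (p s) = 0) :
    -(((X.filter fun s => p s ∉ X).filter c).card : ℤ) ≤ ∑ s ∈ X, (H s - H (p s)) ∧
      ∑ s ∈ X, (H s - H (p s)) ≤ (X.filter fun s => p s ∉ X).card := by
  rw [sum_sub_shift X p q hpq hqp]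
  have h1 : 0 ≤ ∑ s ∈ X with q s ∉ X, H s :=
    Finset.sum_nonneg fun s hs => (hH s (Finset.mem_filter.1 hs).1).1
  have h2 : ∑ s ∈ X with q s ∉ X, H s ≤ (X.filter fun s => p s ∉ X).card := by
    rw [← card_filter_shift X p q hpq hqp]
    simpa using Finset.sum_le_card_nsmul _ H 1 fun s hs => (hH s (Finset.mem_filter.1 hs).1).2
  have h3 : 0 ≤ ∑ s ∈ X with p s ∉ X, H (p s) :=
    Finset.sum_nonneg fun s hs => (hp s (Finset.mem_filter.1 hs).1).1
  have h4 : ∑ s ∈ X with p s ∉ X, H (p s) ≤ ((X.filter fun s => p s ∉ X).filter c).card := by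
    rw [← Finset.sum_boole]
    refine Finset.sum_le_sum fun s hs => ?_
    have hs := (Finset.mem_filter.1 hs).1
    split_ifs with h
    · exact (hp s hs).2
    · exact (hc s hs h).le
  omega

theorem fsum_hPrefix (M : ℕ × ℕ → ℤ) (i j : ℕ) :
    fsum M (hPrefix i j) = ∑ k ∈ Finset.Icc 1 j, M (i, k) := by
  simp [fsum, hPrefix]

theorem fsum_vPrefix (M : ℕ × ℕ → ℤ) (i j : ℕ) :
    fsum M (vPrefix i j) = ∑ k ∈ Finset.Icc 1 i, M (k, j) := by
  simp [fsum, vPrefix]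

theorem IsPASM.horizontal_bounds {m n : ℕ} {M : ℕ × ℕ → ℤ} (hM : IsPASM m n M)
    {X : Finset (ℕ × ℕ)} (hX : X ⊆ Smn m n) :
    pasmPstar1 X ≤ fsum M X ∧ fsum M X ≤ sigma1 X := by
  have hB : ∀ i j, 1 ≤ i → i ≤ m → j ≤ n →
      0 ≤ fsum M (hPrefix i j) ∧ fsum M (hPrefix i j) ≤ 1 := by
    intro i j hi hi' hj
    rcases Nat.eq_zero_or_pos j with rfl | hj0
    · simp [fsum_hPrefix]
    · have := (hM i (Finset.mem_Icc.2 ⟨hi, hi'⟩) j (Finset.mem_Icc.2 ⟨hj0, hj⟩)).1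
      omega
  have hsum : fsum M X =
      ∑ s ∈ X, (fsum M (hPrefix s.1 s.2) - fsum M (hPrefix s.1 (s.2 - 1))) := by
    refine Finset.sum_congr rfl fun s hs => ?_
    obtain ⟨i, j⟩ := s
    have := mem_Smn.1 (hX hs)
    obtain ⟨k, rfl⟩ : ∃ k, j = k + 1 := ⟨j - 1, by simp at this; omega⟩
    simp [fsum_hPrefix, Finset.sum_Icc_succ_top]
  rw [hsum]
  refine sum_sub_shift_bounds X (fun s => (s.1, s.2 - 1)) (fun s => (s.1, s.2 + 1))
    (fun s => by simp) (succ_pred_snd hX) (fun s => fsum M (hPrefix s.1 s.2))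
    (fun s => s.2 ≠ 1) ?_ ?_ ?_
  · intro s hs
    have := mem_Smn.1 (hX hs)
    exact hB _ _ (by omega) (by omega) (by omega)
  · intro s hs
    have := mem_Smn.1 (hX hs)
    exact hB _ _ (by simp; omega) (by simp; omega) (by simp; omega)
  · intro s _ hc
    simp at hc
    simp [hc, fsum_hPrefix]

theorem IsPASM.vertical_bounds {m n : ℕ} {M : ℕ × ℕ → ℤ} (hM : IsPASM m n M)
    {X : Finset (ℕ × ℕ)} (hX : X ⊆ Smn m n) :
    pasmPstar2 X ≤ fsum M X ∧ fsum M X ≤ sigma2 X := by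
  have hB : ∀ i j, i ≤ m → 1 ≤ j → j ≤ n →
      0 ≤ fsum M (vPrefix i j) ∧ fsum M (vPrefix i j) ≤ 1 := by
    intro i j hi hj hj'
    rcases Nat.eq_zero_or_pos i with rfl | hi0
    · simp [fsum_vPrefix]
    · have := (hM i (Finset.mem_Icc.2 ⟨hi0, hi⟩) j (Finset.mem_Icc.2 ⟨hj, hj'⟩)).2
      omega
  have hsum : fsum M X =
      ∑ s ∈ X, (fsum M (vPrefix s.1 s.2) - fsum M (vPrefix (s.1 - 1) s.2)) := by
    refine Finset.sum_congr rfl fun s hs => ?_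
    obtain ⟨i, j⟩ := s
    have := mem_Smn.1 (hX hs)
    obtain ⟨k, rfl⟩ : ∃ k, i = k + 1 := ⟨i - 1, by simp at this; omega⟩
    simp [fsum_vPrefix, Finset.sum_Icc_succ_top]
  rw [hsum]
  refine sum_sub_shift_bounds X (fun s => (s.1 - 1, s.2)) (fun s => (s.1 + 1, s.2))
    (fun s => by simp) (succ_pred_fst hX) (fun s => fsum M (vPrefix s.1 s.2))
    (fun s => s.1 ≠ 1) ?_ ?_ ?_
  · intro s hs
    have := mem_Smn.1 (hX hs)
    exact hB _ _ (by omega) (by omega) (by omega)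
  · intro s hs
    have := mem_Smn.1 (hX hs)
    exact hB _ _ (by simp; omega) (by simp; omega) (by simp; omega)
  · intro s _ hc
    simp at hc
    simp [hc, fsum_vPrefix]

theorem fsum_sdiff_add (x : ℕ × ℕ → ℤ) (X Y : Finset (ℕ × ℕ)) :
    fsum x (X \ Y) + fsum x (X ∩ Y) = fsum x X := by
  rw [add_comm]
  exact Finset.sum_inter_add_sum_sdiff X Y x

theorem fsum_mono {x y : ℕ × ℕ → ℤ} {X : Finset (ℕ × ℕ)} (h : ∀ s ∈ X, x s ≤ y s) :
    fsum x X ≤ fsum y X :=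
  Finset.sum_le_sum h

end Necessity

section Network

/-- The arcs of the network: horizontal prefix sums, vertical prefix sums, entries, and the
return arc. -/
abbrev PasmArc : Type := ((ℕ × ℕ) ⊕ (ℕ × ℕ)) ⊕ ((ℕ × ℕ) ⊕ Unit)

/-- Tails of the arcs. The nodes `(true, some s)` and `(false, some s)` are the row and column
copies of the position `s`; `(true, none)` is the source and `(false, none)` the sink. -/
def pasmSrc (n : ℕ) : PasmArc → Bool × Option (ℕ × ℕ) :=
  Sum.elim
    (Sum.elim (fun s => (true, if s.2 = n then none else some (s.1, s.2 + 1)))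
      (fun s => (false, some s)))
    (Sum.elim (fun s => (true, some s)) (fun _ => (false, none)))

/-- Heads of the arcs. -/
def pasmTgt (m : ℕ) : PasmArc → Bool × Option (ℕ × ℕ) :=
  Sum.elim
    (Sum.elim (fun s => (true, some s))
      (fun s => (false, if s.1 = m then none else some (s.1 + 1, s.2))))
    (Sum.elim (fun s => (false, some s)) (fun _ => (true, none)))

/-- Arc capacities with constant value `c` on the prefix arcs. -/
def pasmCap (c : ℤ) (x : ℕ × ℕ → ℤ) (γ : ℤ) : PasmArc → ℤ :=
  Sum.elim (Sum.elim (fun _ => c) (fun _ => c)) (Sum.elim x (fun _ => γ))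

/-- All arcs of the network. -/
def pasmArcs (m n : ℕ) : Finset PasmArc :=
  ((Smn m n).disjSum (Smn m n)).disjSum ((Smn m n).disjSum Finset.univ)

theorem pasm_cutSlack (m n : ℕ) (l u : PasmArc → ℤ) (Z : Set (Bool × Option (ℕ × ℕ))) :
    cutSlack (pasmArcs m n) (pasmSrc n) (pasmTgt m) l u Z =
      (∑ s ∈ Smn m n, arcSlack ((true, if s.2 = n then none else some (s.1, s.2 + 1)) ∈ Z)
          ((true, some s) ∈ Z) (l (.inl (.inl s))) (u (.inl (.inl s))) +
        ∑ s ∈ Smn m n, arcSlack ((false, some s) ∈ Z)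
          ((false, if s.1 = m then none else some (s.1 + 1, s.2)) ∈ Z)
          (l (.inl (.inr s))) (u (.inl (.inr s)))) +
      (∑ s ∈ Smn m n, arcSlack ((true, some s) ∈ Z) ((false, some s) ∈ Z)
          (l (.inr (.inl s))) (u (.inr (.inl s))) +
        arcSlack ((false, none) ∈ Z) ((true, none) ∈ Z)
          (l (.inr (.inr ()))) (u (.inr (.inr ())))) := by
  simp only [cutSlack, pasmArcs, Finset.sum_disjSum, Finset.univ_unique, Finset.sum_singleton]
  rfl

/-- The four inequalities say that every cut of the network has nonnegative slack, according to
which of the source and the sink it contains. -/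
theorem cutSlack_pasmCap_nonneg {m n : ℕ} {f g : ℕ × ℕ → ℤ} {α β : ℤ}
    (h : ∀ X₁ ⊆ Smn m n, ∀ X₂ ⊆ Smn m n,
        (pasmPstar1 X₁ + fsum f (X₂ \ X₁) ≤
          (sigma2 X₂ : ℤ) + fsum g (X₁ \ X₂)) ∧
        (pasmPstar2 X₂ + fsum f (X₁ \ X₂) ≤
          (sigma1 X₁ : ℤ) + fsum g (X₂ \ X₁)) ∧
        (α ≤ (sigma1 X₁ : ℤ) + (sigma2 X₂ : ℤ) +
          fsum g ((Smn m n \ X₁) ∩ (Smn m n \ X₂)) - fsum f (X₁ ∩ X₂)) ∧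
        (pasmPstar1 X₁ + pasmPstar2 X₂ +
          fsum f ((Smn m n \ X₁) ∩ (Smn m n \ X₂)) - fsum g (X₁ ∩ X₂) ≤ β))
    (Z : Set (Bool × Option (ℕ × ℕ))) :
    0 ≤ cutSlack (pasmArcs m n) (pasmSrc n) (pasmTgt m) (pasmCap 0 f α) (pasmCap 1 g β) Z := by
  classical
  have hside : ∀ c : Bool, ∃ A ⊆ Smn m n, ∀ s ∈ Smn m n, ((c, some s) ∈ Z ↔ s ∈ A) := fun c =>
    ⟨(Smn m n).filter fun s => (c, some s) ∈ Z, Finset.filter_subset _ _, fun s hs => by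
      simp [hs]⟩
  obtain ⟨A, hAS, mA⟩ := hside true
  obtain ⟨B, hBS, mB⟩ := hside false
  have hAc : Smn m n \ A ⊆ Smn m n := Finset.sdiff_subset
  have hBc : Smn m n \ B ⊆ Smn m n := Finset.sdiff_subset
  have entries : ∑ s ∈ Smn m n,
        arcSlack ((true, some s) ∈ Z) ((false, some s) ∈ Z) (f s) (g s) =
      fsum g (A \ B) - fsum f (B \ A) := by
    unfold arcSlack
    rw [Finset.sum_sub_distrib, ← Finset.sum_filter, ← Finset.sum_filter, fsum, fsum]
    congr 2
    · ext s
      rw [Finset.mem_filter, Finset.mem_sdiff]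
      have := mA s
      have := mB s
      have := @hAS s
      tauto
    · ext s
      rw [Finset.mem_filter, Finset.mem_sdiff]
      have := mA s
      have := mB s
      have := @hBS s
      tauto
  have right_mem : ∀ s ∈ Smn m n, (s.1, s.2 + 1) ∈ Smn m n ↔ s.2 ≠ n := by
    intro s hs
    rw [mem_Smn] at hs ⊢
    simp only
    omega
  have below_mem : ∀ s ∈ Smn m n, (s.1 + 1, s.2) ∈ Smn m n ↔ s.1 ≠ m := by
    intro s hs
    rw [mem_Smn] at hs ⊢
    simp only
    omega
  have rowOut : (true, none) ∉ Z → ∑ s ∈ Smn m n,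
      arcSlack ((true, if s.2 = n then none else some (s.1, s.2 + 1)) ∈ Z)
        ((true, some s) ∈ Z) 0 1 = -pasmPstar1 A := by
    intro hS
    rw [pasmPstar1_eq_sum hAS, neg_neg]
    refine Finset.sum_congr rfl fun s hs => ?_
    have shifted : (true, if s.2 = n then none else some (s.1, s.2 + 1)) ∈ Z ↔ (s.1, s.2 + 1) ∈ A := by
      split_ifs with hn
      · exact iff_of_false hS fun h => (right_mem s hs).1 (hAS h) hn
      · exact mA _ ((right_mem s hs).2 hn)
    rw [shifted, mA s hs]
    simp [arcSlack, and_comm]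
  have rowIn : (true, none) ∈ Z → ∑ s ∈ Smn m n,
      arcSlack ((true, if s.2 = n then none else some (s.1, s.2 + 1)) ∈ Z)
        ((true, some s) ∈ Z) 0 1 = sigma1 (Smn m n \ A) := by
    intro hS
    rw [sigma1_eq_sum hAc]
    refine Finset.sum_congr rfl fun s hs => ?_
    have shifted : (true, if s.2 = n then none else some (s.1, s.2 + 1)) ∈ Z ↔ (s.1, s.2 + 1) ∉ Smn m n \ A := by
      split_ifs with hn
      · exact iff_of_true hS fun h => (right_mem s hs).1 (Finset.mem_sdiff.1 h).1 hn
      · have hq := (right_mem s hs).2 hn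
        rw [mA _ hq, Finset.mem_sdiff]
        tauto
    rw [shifted, mA s hs]
    simp [arcSlack, hs, and_comm]
  have colOut : (false, none) ∉ Z → ∑ s ∈ Smn m n,
      arcSlack ((false, some s) ∈ Z)
        ((false, if s.1 = m then none else some (s.1 + 1, s.2)) ∈ Z) 0 1 = sigma2 B := by
    intro hT
    rw [sigma2_eq_sum hBS]
    refine Finset.sum_congr rfl fun s hs => ?_
    have shifted : (false, if s.1 = m then none else some (s.1 + 1, s.2)) ∈ Z ↔ (s.1 + 1, s.2) ∈ B := by
      split_ifs with hn
      · exact iff_of_false hT fun h => (below_mem s hs).1 (hBS h) hn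
      · exact mB _ ((below_mem s hs).2 hn)
    rw [shifted, mB s hs]
    simp [arcSlack, and_comm]
  have colIn : (false, none) ∈ Z → ∑ s ∈ Smn m n,
      arcSlack ((false, some s) ∈ Z)
        ((false, if s.1 = m then none else some (s.1 + 1, s.2)) ∈ Z) 0 1 = -pasmPstar2 (Smn m n \ B) := by
    intro hT
    rw [pasmPstar2_eq_sum hBc, neg_neg]
    refine Finset.sum_congr rfl fun s hs => ?_
    have shifted : (false, if s.1 = m then none else some (s.1 + 1, s.2)) ∈ Z ↔ (s.1 + 1, s.2) ∉ Smn m n \ B := by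
      split_ifs with hn
      · exact iff_of_true hT fun h => (below_mem s hs).1 (Finset.mem_sdiff.1 h).1 hn
      · have hq := (below_mem s hs).2 hn
        rw [mB _ hq, Finset.mem_sdiff]
        tauto
    rw [shifted, mB s hs]
    simp [arcSlack, hs, and_comm]
  have cc : ∀ X Y : Finset (ℕ × ℕ), X ⊆ Smn m n →
      (Smn m n \ (Smn m n \ X)) ∩ (Smn m n \ Y) = X \ Y := by
    intro X Y hX
    ext s
    have := @hX s
    simp
    tauto
  have ci : ∀ X Y : Finset (ℕ × ℕ), X ⊆ Smn m n → (Smn m n \ Y) ∩ X = X \ Y := by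
    intro X Y hX
    ext s
    have := @hX s
    simp
    tauto
  have cs : ∀ X Y : Finset (ℕ × ℕ), X ⊆ Smn m n →
      (Smn m n \ Y) \ (Smn m n \ X) = X \ Y := by
    intro X Y hX
    ext s
    have := @hX s
    simp
    tauto
  rw [pasm_cutSlack]
  simp only [pasmCap, Sum.elim_inl, Sum.elim_inr, entries]
  by_cases hS : (true, none) ∈ Z <;> by_cases hT : (false, none) ∈ Z
  · rw [rowIn hS, colIn hT]
    have := (h _ hAc _ hBc).2.1
    rw [cs B A hBS, cs A B hAS] at this
    simp only [arcSlack, hS, hT]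
    simp
    omega
  · rw [rowIn hS, colOut hT]
    have := (h _ hAc _ hBS).2.2.1
    rw [cc A B hAS, ci B A hBS] at this
    simp only [arcSlack, hS, hT]
    simp
    omega
  · rw [rowOut hS, colIn hT]
    have := (h _ hAS _ hBc).2.2.2
    rw [Finset.inter_comm, cc B A hBS, Finset.inter_comm, ci A B hAS] at this
    simp only [arcSlack, hS, hT]
    simp
    omega
  · rw [rowOut hS, colOut hT]
    have := (h _ hAS _ hBS).1
    simp only [arcSlack, hS, hT]
    simp
    omega

/-- The horizontal prefix sums of the entry part of a circulation are its horizontal arc values. -/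
theorem fsum_hPrefix_of_circulation {m n : ℕ} {x : PasmArc → ℤ}
    (hx : ∀ Z, cutSlack (pasmArcs m n) (pasmSrc n) (pasmTgt m) x x Z = 0) {i j : ℕ}
    (hs : (i, j) ∈ Smn m n) :
    fsum (fun s => x (.inr (.inl s))) (hPrefix i j) = x (.inl (.inl (i, j))) := by
  classical
  have hij := mem_Smn.1 hs
  simp only at hij
  have h := hx {v | ∃ k ≤ j, v = (true, some (i, k))}
  rw [pasm_cutSlack] at h
  have prefixSum : fsum (fun s => x (.inr (.inl s))) (hPrefix i j) =
      ∑ s ∈ Smn m n, if s.1 = i ∧ s.2 ≤ j then x (.inr (.inl s)) else 0 := by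
    rw [← Finset.sum_filter, fsum]
    congr 1
    ext s
    simp only [hPrefix, Finset.mem_product, Finset.mem_singleton, Finset.mem_Icc,
      Finset.mem_filter, mem_Smn]
    omega
  have row_mem : ∀ s : ℕ × ℕ, ((true, some s) ∈
      {v : Bool × Option (ℕ × ℕ) | ∃ k ≤ j, v = (true, some (i, k))}) ↔ s.1 = i ∧ s.2 ≤ j := by
    rintro ⟨a, b⟩
    simp
    grind
  have shift_mem : ∀ s ∈ Smn m n, ((true, if s.2 = n then none else some (s.1, s.2 + 1)) ∈
      {v : Bool × Option (ℕ × ℕ) | ∃ k ≤ j, v = (true, some (i, k))}) ↔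
        s.1 = i ∧ s.2 + 1 ≤ j := by
    intro s hs
    split_ifs with hn
    · simp
      omega
    · rw [row_mem]
  have other_notMem : ∀ o : Option (ℕ × ℕ), (false, o) ∉
      {v : Bool × Option (ℕ × ℕ) | ∃ k ≤ j, v = (true, some (i, k))} := by
    simp
  have terminal_notMem : (true, none) ∉
      {v : Bool × Option (ℕ × ℕ) | ∃ k ≤ j, v = (true, some (i, k))} := by
    simp
  have prefixArcs : ∑ s ∈ Smn m n,
      arcSlack ((true, if s.2 = n then none else some (s.1, s.2 + 1)) ∈
          {v : Bool × Option (ℕ × ℕ) | ∃ k ≤ j, v = (true, some (i, k))})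
        ((true, some s) ∈ {v : Bool × Option (ℕ × ℕ) | ∃ k ≤ j, v = (true, some (i, k))})
        (x (.inl (.inl s))) (x (.inl (.inl s))) = - x (.inl (.inl (i, j))) := by
    rw [Finset.sum_eq_single_of_mem (i, j) hs]
    · rw [row_mem, shift_mem _ hs]
      simp [arcSlack]
    · intro s hs hne
      have : ¬ (s.1 = i ∧ s.2 = j) := fun h => hne (Prod.ext h.1 h.2)
      rw [row_mem, shift_mem _ hs, arcSlack, if_neg (by omega), if_neg (by omega), sub_zero]
  rw [prefixArcs] at h
  simp only [arcSlack, row_mem, other_notMem, terminal_notMem, false_and, if_false, sub_zero,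
    Finset.sum_const_zero, not_false_eq_true, and_true, add_zero] at h
  rw [prefixSum]
  omega

/-- The vertical prefix sums of the entry part of a circulation are its vertical arc values. -/
theorem fsum_vPrefix_of_circulation {m n : ℕ} {x : PasmArc → ℤ}
    (hx : ∀ Z, cutSlack (pasmArcs m n) (pasmSrc n) (pasmTgt m) x x Z = 0) {i j : ℕ}
    (hs : (i, j) ∈ Smn m n) :
    fsum (fun s => x (.inr (.inl s))) (vPrefix i j) = x (.inl (.inr (i, j))) := by
  classical
  have hij := mem_Smn.1 hs
  simp only at hij
  have h := hx {v | ∃ k ≤ i, v = (false, some (k, j))}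
  rw [pasm_cutSlack] at h
  have prefixSum : fsum (fun s => x (.inr (.inl s))) (vPrefix i j) =
      ∑ s ∈ Smn m n, if s.1 ≤ i ∧ s.2 = j then x (.inr (.inl s)) else 0 := by
    rw [← Finset.sum_filter, fsum]
    congr 1
    ext s
    simp only [vPrefix, Finset.mem_product, Finset.mem_singleton, Finset.mem_Icc,
      Finset.mem_filter, mem_Smn]
    omega
  have row_mem : ∀ s : ℕ × ℕ, ((false, some s) ∈
      {v : Bool × Option (ℕ × ℕ) | ∃ k ≤ i, v = (false, some (k, j))}) ↔ s.1 ≤ i ∧ s.2 = j := by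
    rintro ⟨a, b⟩
    simp
  have shift_mem : ∀ s ∈ Smn m n, ((false, if s.1 = m then none else some (s.1 + 1, s.2)) ∈
      {v : Bool × Option (ℕ × ℕ) | ∃ k ≤ i, v = (false, some (k, j))}) ↔
        s.1 + 1 ≤ i ∧ s.2 = j := by
    intro s hs
    split_ifs with hn
    · simp
      omega
    · rw [row_mem]
  have other_notMem : ∀ o : Option (ℕ × ℕ), (true, o) ∉
      {v : Bool × Option (ℕ × ℕ) | ∃ k ≤ i, v = (false, some (k, j))} := by
    simp
  have terminal_notMem : (false, none) ∉
      {v : Bool × Option (ℕ × ℕ) | ∃ k ≤ i, v = (false, some (k, j))} := by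
    simp
  have prefixArcs : ∑ s ∈ Smn m n,
      arcSlack ((false, some s) ∈
          {v : Bool × Option (ℕ × ℕ) | ∃ k ≤ i, v = (false, some (k, j))})
        ((false, if s.1 = m then none else some (s.1 + 1, s.2)) ∈
          {v : Bool × Option (ℕ × ℕ) | ∃ k ≤ i, v = (false, some (k, j))})
        (x (.inl (.inr s))) (x (.inl (.inr s))) = x (.inl (.inr (i, j))) := by
    rw [Finset.sum_eq_single_of_mem (i, j) hs]
    · rw [row_mem, shift_mem _ hs]
      simp [arcSlack]
    · intro s hs hne
      have : ¬ (s.1 = i ∧ s.2 = j) := fun h => hne (Prod.ext h.1 h.2)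
      rw [row_mem, shift_mem _ hs, arcSlack, if_neg (by omega), if_neg (by omega), sub_zero]
  rw [prefixArcs] at h
  simp only [arcSlack, row_mem, other_notMem, terminal_notMem, false_and, if_false, sub_zero, zero_sub,
    Finset.sum_const_zero, not_false_eq_true, and_true, add_zero, zero_add,
    Finset.sum_neg_distrib] at h
  rw [prefixSum]
  omega

/-- The total sum of the entry part of a circulation is the value of the return arc. -/
theorem fsum_Smn_of_circulation {m n : ℕ} {x : PasmArc → ℤ}
    (hx : ∀ Z, cutSlack (pasmArcs m n) (pasmSrc n) (pasmTgt m) x x Z = 0) :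
    fsum (fun s => x (.inr (.inl s))) (Smn m n) = x (.inr (.inr ())) := by
  have h := hx {v | v.1 = true}
  rw [pasm_cutSlack] at h
  simp [arcSlack] at h
  rw [fsum]
  omega

end Network

/-- feasibility of partial alternating sign matrices with entry
bounds and total-sum bounds (Theorem PASM). -/
theorem stmt_19 (m n : ℕ) (hm : 1 ≤ m) (hn : 1 ≤ n)
    (f g : ℕ × ℕ → ℤ) (hfg : ∀ s ∈ Smn m n, f s ≤ g s)
    (α β : ℤ) (hαβ : α ≤ β) :
    (∃ M : ℕ × ℕ → ℤ, IsPASM m n M ∧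
        (∀ s ∈ Smn m n, f s ≤ M s ∧ M s ≤ g s) ∧
        (α ≤ fsum M (Smn m n) ∧ fsum M (Smn m n) ≤ β)) ↔
      (∀ X₁ ⊆ Smn m n, ∀ X₂ ⊆ Smn m n,
        (pasmPstar1 X₁ + fsum f (X₂ \ X₁) ≤
          (sigma2 X₂ : ℤ) + fsum g (X₁ \ X₂)) ∧
        (pasmPstar2 X₂ + fsum f (X₁ \ X₂) ≤
          (sigma1 X₁ : ℤ) + fsum g (X₂ \ X₁)) ∧
        (α ≤ (sigma1 X₁ : ℤ) + (sigma2 X₂ : ℤ) +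
          fsum g ((Smn m n \ X₁) ∩ (Smn m n \ X₂)) - fsum f (X₁ ∩ X₂)) ∧
        (pasmPstar1 X₁ + pasmPstar2 X₂ +
          fsum f ((Smn m n \ X₁) ∩ (Smn m n \ X₂)) - fsum g (X₁ ∩ X₂) ≤ β)) := by
  constructor
  · rintro ⟨M, hM, hb, hα, hβ⟩ X₁ hX₁ X₂ hX₂
    obtain ⟨h1, h1'⟩ := hM.horizontal_bounds hX₁
    obtain ⟨h2, h2'⟩ := hM.vertical_bounds hX₂
    have s1 := fsum_sdiff_add M X₁ X₂
    have s2 := fsum_sdiff_add M X₂ X₁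
    rw [Finset.inter_comm] at s2
    have lo : ∀ X ⊆ Smn m n, fsum f X ≤ fsum M X ∧ fsum M X ≤ fsum g X := fun X hX =>
      ⟨fsum_mono fun s hs => (hb s (hX hs)).1, fsum_mono fun s hs => (hb s (hX hs)).2⟩
    have b1 := lo (X₁ \ X₂) (Finset.sdiff_subset.trans hX₁)
    have b2 := lo (X₂ \ X₁) (Finset.sdiff_subset.trans hX₂)
    have b3 := lo (X₁ ∩ X₂) (Finset.inter_subset_left.trans hX₁)
    have b4 := lo ((Smn m n \ X₁) ∩ (Smn m n \ X₂))
      (Finset.inter_subset_left.trans Finset.sdiff_subset)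
    have s3 := fsum_sdiff_add M (Smn m n) X₁
    have s4 := fsum_sdiff_add M (Smn m n \ X₁) (Smn m n \ X₂)
    have e1 : Smn m n ∩ X₁ = X₁ := Finset.inter_eq_right.2 hX₁
    have e2 : (Smn m n \ X₁) \ (Smn m n \ X₂) = X₂ \ X₁ := by
      ext s
      have := @hX₂ s
      simp
      tauto
    rw [e1] at s3
    rw [e2] at s4
    refine ⟨?_, ?_, ?_, ?_⟩ <;> omega
  · intro h
    obtain ⟨x, hx, hc⟩ := exists_circulation (pasmArcs m n) (pasmSrc n) (pasmTgt m)
      (pasmCap 0 f α) (pasmCap 1 g β) (by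
        rintro ((s | s) | (s | s)) hs
        · simp [pasmCap]
        · simp [pasmCap]
        · simp only [pasmArcs, Finset.inr_mem_disjSum, Finset.inl_mem_disjSum] at hs
          exact hfg s hs
        · exact hαβ) (cutSlack_pasmCap_nonneg h)
    refine ⟨fun s => x (.inr (.inl s)), ?_, ?_, ?_⟩
    · intro i hi j hj
      have hs : (i, j) ∈ Smn m n := Finset.mem_product.2 ⟨hi, hj⟩
      rw [fsum_hPrefix_of_circulation hc hs, fsum_vPrefix_of_circulation hc hs]
      have b1 := hx (.inl (.inl (i, j))) (by simpa [pasmArcs] using hs)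
      have b2 := hx (.inl (.inr (i, j))) (by simpa [pasmArcs] using hs)
      simp only [pasmCap, Sum.elim_inl, Sum.elim_inr] at b1 b2
      omega
    · intro s hs
      exact hx (.inr (.inl s)) (by simpa [pasmArcs] using hs)
    · rw [fsum_Smn_of_circulation hc]
      exact hx (.inr (.inr ())) (by simp [pasmArcs])
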